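/- Let X be a GC_5 set of 21 nodes with no maximal line, and let A0 ∈ X be a node with m-d sequence (5,5,5,3,2) realized by the ordered used lines (ℓ1,ℓ2,ℓ3,ℓ4,ℓ5); set 𝒜 := X ∩ (ℓ1 ∪ ℓ2 ∪ ℓ3) (#𝒜 = 15). Suppose a line ℓ̃ ∉ {ℓ1,ℓ2,ℓ3} does not intersect some line ℓ ∈ {ℓ1,ℓ2,ℓ3} at a node of X. Then ℓ̃ is used by at most one node of 𝒜, and any node of 𝒜 using ℓ̃ lies on ℓ. -/

import Mathlib

open MvPolynomial

/-- Evaluation of a bivariate polynomial at a point of the real plane. -/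
noncomputable def ev (p : MvPolynomial (Fin 2) ℝ) (A : ℝ × ℝ) : ℝ :=
  MvPolynomial.eval ![A.1, A.2] p

/-- A polynomial of total degree exactly 1, defining a line. -/
def IsLinePoly (l : MvPolynomial (Fin 2) ℝ) : Prop := l.totalDegree = 1

/-- The line (zero set) defined by a polynomial. -/
def lineSet (l : MvPolynomial (Fin 2) ℝ) : Set (ℝ × ℝ) := {A | ev l A = 0}

/-- The number of nodes of `X` lying on the line defined by `l`. -/
noncomputable def nodesOn (X : Set (ℝ × ℝ)) (l : MvPolynomial (Fin 2) ℝ) : ℕ :=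
  (X ∩ lineSet l).ncard

/-- `X` is an `n`-poised set: it has `N = (n+2)(n+1)/2` nodes and the only polynomial of
degree ≤ n vanishing on all of `X` is the zero polynomial. -/
def Poised (n : ℕ) (X : Set (ℝ × ℝ)) : Prop :=
  X.Finite ∧ X.ncard = (n + 2) * (n + 1) / 2 ∧
    ∀ p : MvPolynomial (Fin 2) ℝ, p.totalDegree ≤ n → (∀ A ∈ X, ev p A = 0) → p = 0

/-- `p` is an `n`-fundamental polynomial of the node `A` with respect to `X`. -/
def IsFund (n : ℕ) (X : Set (ℝ × ℝ)) (A : ℝ × ℝ) (p : MvPolynomial (Fin 2) ℝ) : Prop :=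
  p.totalDegree ≤ n ∧ ev p A = 1 ∧ ∀ B ∈ X, B ≠ A → ev p B = 0

/-- `X` is a `GC_n` set: it is `n`-poised and each fundamental polynomial is a product of
`n` linear (degree-1) polynomials. -/
def GCSet (n : ℕ) (X : Set (ℝ × ℝ)) : Prop :=
  Poised n X ∧ ∀ A ∈ X, ∃ p : MvPolynomial (Fin 2) ℝ, IsFund n X A p ∧
    ∃ f : Fin n → MvPolynomial (Fin 2) ℝ, (∀ i, IsLinePoly (f i)) ∧ p = ∏ i, f i

/-- The node `A` uses the line `l`: the linear polynomial `l` divides a fundamental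
polynomial of `A`. -/
def Uses (n : ℕ) (X : Set (ℝ × ℝ)) (A : ℝ × ℝ) (l : MvPolynomial (Fin 2) ℝ) : Prop :=
  ∃ p, IsFund n X A p ∧ l ∣ p

/-- `X` has no maximal line, i.e. no line passes through `n+1` nodes of `X`. -/
def NoMaximalLine (n : ℕ) (X : Set (ℝ × ℝ)) : Prop :=
  ∀ l : MvPolynomial (Fin 2) ℝ, IsLinePoly l → nodesOn X l ≠ n + 1

/-- Number of nodes of `X` on the line `l` which do not lie on any of the lines
`L 0, …, L (s-1)` (the primary node count of `l` at step `s`). -/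
noncomputable def resCount (X : Set (ℝ × ℝ)) (L : Fin 5 → MvPolynomial (Fin 2) ℝ)
    (s : Fin 5) (l : MvPolynomial (Fin 2) ℝ) : ℕ :=
  {B ∈ X | ev l B = 0 ∧ ∀ i : Fin 5, i < s → ev (L i) B ≠ 0}.ncard

/-- `L` is an m-line sequence of the node `A` of the `GC_5` set `X`: it enumerates the five
distinct used lines of `A` (a fundamental polynomial of `A` is, up to a constant, the
product of the `L i`), ordered greedily: at each step `s` the line `L s` has maximal
primary node count among the remaining used lines. -/
def MLineSeq (X : Set (ℝ × ℝ)) (A : ℝ × ℝ) (L : Fin 5 → MvPolynomial (Fin 2) ℝ) : Prop :=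
  (∀ i, IsLinePoly (L i)) ∧
  (∀ i j : Fin 5, i ≠ j → lineSet (L i) ≠ lineSet (L j)) ∧
  (∃ p : MvPolynomial (Fin 2) ℝ, IsFund 5 X A p ∧ ∃ c : ℝ, p = MvPolynomial.C c * ∏ i, L i) ∧
  (∀ s t : Fin 5, s ≤ t → resCount X L s (L t) ≤ resCount X L s (L s))

/-- The node `A` has m-distribution sequence `k`. -/
def HasMDSeq (X : Set (ℝ × ℝ)) (A : ℝ × ℝ) (k : Fin 5 → ℕ) : Prop :=
  ∃ L : Fin 5 → MvPolynomial (Fin 2) ℝ, MLineSeq X A L ∧ ∀ s, resCount X L s (L s) = k s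

theorem ev_mul (p q : MvPolynomial (Fin 2) ℝ) (A : ℝ × ℝ) : ev (p * q) A = ev p A * ev q A := by
  simp [ev]

theorem ev_add (p q : MvPolynomial (Fin 2) ℝ) (A : ℝ × ℝ) : ev (p + q) A = ev p A + ev q A := by
  simp [ev]

theorem ev_C (c : ℝ) (A : ℝ × ℝ) : ev (C c) A = c := by
  simp [ev]

/-- A polynomial of total degree one is an affine form with a nonzero linear part. -/
theorem IsLinePoly.exists_eq {l : MvPolynomial (Fin 2) ℝ} (hl : IsLinePoly l) :
    ∃ a b c : ℝ, (a ≠ 0 ∨ b ≠ 0) ∧ l = C a * X 0 + C b * X 1 + C c := by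
  have key : l = C (coeff (Finsupp.single 0 1) l) * X 0 + C (coeff (Finsupp.single 1 1) l) * X 1
      + C (coeff 0 l) := by
    ext m
    by_cases hm : 1 < m.sum fun _ e => e
    · have h0 : m ≠ 0 := by rintro rfl; simp at hm
      have h1 : ∀ i : Fin 2, m ≠ Finsupp.single i 1 := by rintro i rfl; simp at hm
      have hz : coeff m l = 0 := coeff_eq_zero_of_totalDegree_lt (by
        rw [show l.totalDegree = 1 from hl]; exact hm)
      simp [hz, coeff_C, coeff_C_mul, coeff_X, h0.symm, (h1 _).symm]
    · have hsum : m 0 + m 1 ≤ 1 := by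
        rw [Finsupp.sum_fintype _ _ (fun _ => rfl), Fin.sum_univ_two] at hm
        omega
      have hcases : m = 0 ∨ m = Finsupp.single 0 1 ∨ m = Finsupp.single 1 1 := by
        rcases (by omega : (m 0 = 0 ∧ m 1 = 0) ∨ (m 0 = 1 ∧ m 1 = 0) ∨ (m 0 = 0 ∧ m 1 = 1))
          with h | h | h
        · left; ext i; fin_cases i <;> simp [h.1, h.2]
        · right; left; ext i; fin_cases i <;> simp [h.1, h.2]
        · right; right; ext i; fin_cases i <;> simp [h.1, h.2]
      rcases hcases with rfl | rfl | rfl <;>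
        simp [coeff_C, coeff_C_mul, coeff_X, Finsupp.single_left_inj,
          eq_comm (a := (0 : Fin 2 →₀ ℕ))]
  refine ⟨_, _, _, ?_, key⟩
  by_contra! h
  rw [h.1, h.2] at key
  have hd : l.totalDegree = 0 := by rw [key]; simp
  rw [show l.totalDegree = 1 from hl] at hd
  exact one_ne_zero hd

theorem ev_affine (a b c : ℝ) (A : ℝ × ℝ) :
    ev (C a * X 0 + C b * X 1 + C c) A = a * A.1 + b * A.2 + c := by
  simp [ev]

/-- A polynomial of degree at most `n` vanishing at more than `n` points of a line is divisible
by the polynomial of the line. -/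
theorem IsLinePoly.dvd_of_card_lt {l p : MvPolynomial (Fin 2) ℝ} (hl : IsLinePoly l) {n : ℕ}
    (hp : p.totalDegree ≤ n) (S : Finset (ℝ × ℝ)) (hS : n < S.card)
    (hlS : ∀ A ∈ S, ev l A = 0) (hpS : ∀ A ∈ S, ev p A = 0) : l ∣ p := by
  obtain ⟨a, b, c, hab, rfl⟩ := hl.exists_eq
  obtain ⟨P, hP⟩ : S.Nonempty := Finset.card_pos.mp (by omega)
  have hPl := hlS P hP
  rw [ev_affine] at hPl
  have hd : a ^ 2 + b ^ 2 ≠ 0 := by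
    rcases hab with h | h <;> positivity
  set d := a ^ 2 + b ^ 2 with hd_def
  -- restriction to the parametrized line, and a retraction of the plane onto it
  let g : Fin 2 → Polynomial ℝ := ![Polynomial.C P.1 + Polynomial.C (-b) * Polynomial.X,
    Polynomial.C P.2 + Polynomial.C a * Polynomial.X]
  let t : MvPolynomial (Fin 2) ℝ := C (-b / d) * (X 0 - C P.1) + C (a / d) * (X 1 - C P.2)
  have hzero : aeval g p = 0 := by
    refine Polynomial.eq_zero_of_natDegree_lt_card_of_eval_eq_zero' _
      (S.image fun A => -b / d * (A.1 - P.1) + a / d * (A.2 - P.2)) ?_ ?_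
    · intro x hx
      obtain ⟨A, hA, rfl⟩ := Finset.mem_image.mp hx
      have hAl := hlS A hA
      rw [ev_affine] at hAl
      have hAp := hpS A hA
      rw [← hAp, ev, ← Polynomial.coe_evalRingHom, ← MvPolynomial.coe_aeval_eq_eval]
      have : ((Polynomial.aeval (-b / d * (A.1 - P.1) + a / d * (A.2 - P.2)) :
          Polynomial ℝ →ₐ[ℝ] ℝ).comp (aeval g)) = aeval ![A.1, A.2] := by
        ext i
        fin_cases i
        · simp [g]
          field_simp
          rw [hd_def]
          linear_combination a * hPl - a * hAl
        · simp [g]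
          field_simp
          rw [hd_def]
          linear_combination b * hPl - b * hAl
      exact DFunLike.congr_fun this p
    · rw [Finset.card_image_of_injOn]
      · refine lt_of_le_of_lt (aeval_natDegree_le p hp g (n := 1) ?_) (by omega)
        intro i
        fin_cases i
        · exact Polynomial.natDegree_add_le_of_degree_le (by simp)
            ((Polynomial.natDegree_C_mul_le _ _).trans Polynomial.natDegree_X_le)
        · exact Polynomial.natDegree_add_le_of_degree_le (by simp)
            ((Polynomial.natDegree_C_mul_le _ _).trans Polynomial.natDegree_X_le)
      · intro A hA B hB hAB
        have hAl := hlS A hA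
        have hBl := hlS B hB
        rw [ev_affine] at hAl hBl
        simp only at hAB
        field_simp at hAB
        have h1 : d * (A.1 - B.1) = 0 := by
          rw [hd_def]; linear_combination a * hAl - a * hBl - b * hAB
        have h2 : d * (A.2 - B.2) = 0 := by
          rw [hd_def]; linear_combination b * hAl - b * hBl + a * hAB
        exact Prod.ext (sub_eq_zero.mp ((mul_eq_zero.mp h1).resolve_left hd))
          (sub_eq_zero.mp ((mul_eq_zero.mp h2).resolve_left hd))
  rw [← Ideal.mem_span_singleton, ← Ideal.Quotient.eq_zero_iff_mem]
  set I : Ideal (MvPolynomial (Fin 2) ℝ) := Ideal.span {C a * X 0 + C b * X 1 + C c}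
  have hcomp : (Ideal.Quotient.mkₐ ℝ I).comp ((Polynomial.aeval t).comp (aeval g)) =
      Ideal.Quotient.mkₐ ℝ I := by
    have hab' : (C d : MvPolynomial (Fin 2) ℝ) = C a ^ 2 + C b ^ 2 := by
      rw [hd_def]; simp
    have hdi : (C d : MvPolynomial (Fin 2) ℝ) * C d⁻¹ = 1 := by
      rw [← C_mul, mul_inv_cancel₀ hd, C_1]
    have hPC : (C a * C P.1 + C b * C P.2 + C c : MvPolynomial (Fin 2) ℝ) = 0 := by
      rw [← C_mul, ← C_mul, ← C_add, ← C_add, hPl, C_0]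
    ext i
    simp only [AlgHom.comp_apply, Ideal.Quotient.mkₐ_eq_mk, aeval_X]
    rw [Ideal.Quotient.eq, Ideal.mem_span_singleton]
    fin_cases i
    · refine ⟨-(C a * C d⁻¹), ?_⟩
      simp [g, t, div_eq_mul_inv, algebraMap_eq]
      linear_combination (X 0 - C P.1) * hdi - (X 0 - C P.1) * C d⁻¹ * hab'
        + C a * C d⁻¹ * hPC
    · refine ⟨-(C b * C d⁻¹), ?_⟩
      simp [g, t, div_eq_mul_inv, algebraMap_eq]
      linear_combination (X 1 - C P.2) * hdi - (X 1 - C P.2) * C d⁻¹ * hab'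
        + C b * C d⁻¹ * hPC
  have := DFunLike.congr_fun hcomp p
  simpa [hzero] using this.symm

theorem IsLinePoly.totalDegree_le_of_mul {l r : MvPolynomial (Fin 2) ℝ} (hl : IsLinePoly l) {n : ℕ}
    (h : (l * r).totalDegree ≤ n + 1) : r.totalDegree ≤ n := by
  have hl' : l.totalDegree = 1 := hl
  by_cases hr : r = 0
  · simp [hr]
  · have hl0 : l ≠ 0 := by rintro rfl; simp at hl'
    rw [totalDegree_mul_of_isDomain hl0 hr] at h
    omega

theorem IsLinePoly.exists_factor {l p : MvPolynomial (Fin 2) ℝ} (hl : IsLinePoly l) {n : ℕ}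
    (hp : p.totalDegree ≤ n + 1) (S : Finset (ℝ × ℝ)) (hS : n + 1 < S.card)
    (hlS : ∀ A ∈ S, ev l A = 0) (hpS : ∀ A ∈ S, ev p A = 0) :
    ∃ r, r.totalDegree ≤ n ∧ p = l * r := by
  obtain ⟨r, rfl⟩ := hl.dvd_of_card_lt hp S hS hlS hpS
  exact ⟨r, hl.totalDegree_le_of_mul hp, rfl⟩

/-- Two distinct lines have at most one point in common. -/
theorem IsLinePoly.eq_of_mem_of_mem {l m : MvPolynomial (Fin 2) ℝ} (hl : IsLinePoly l)
    (hm : IsLinePoly m) (hlm : lineSet l ≠ lineSet m) {A B : ℝ × ℝ} (hlA : ev l A = 0)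
    (hmA : ev m A = 0) (hlB : ev l B = 0) (hmB : ev m B = 0) : A = B := by
  by_contra hAB
  obtain ⟨r, hr, rfl⟩ := hl.exists_factor (n := 0) (p := m) hm.le {A, B}
    (by rw [Finset.card_pair hAB]; norm_num)
    (by simp [hlA, hlB]) (by simp [hmA, hmB])
  rw [totalDegree_eq_zero_iff_eq_C.mp (Nat.le_zero.mp hr)] at hm hlm
  refine hlm (Set.ext fun P => ?_)
  have hc : coeff 0 r ≠ 0 := by
    intro hc
    simp [hc, IsLinePoly] at hm
  simp [lineSet, ev_mul, ev_C, hc]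

/-- A quartic with at least 5, 4 and 3 zeros, respectively, on three lines, none of them on the
preceding lines, vanishes on the third line. -/
theorem ev_eq_zero_of_zeros_on_three_lines {a b c q : MvPolynomial (Fin 2) ℝ} (ha : IsLinePoly a)
    (hb : IsLinePoly b) (hc : IsLinePoly c) (hq : q.totalDegree ≤ 4)
    (Sa Sb Sc : Finset (ℝ × ℝ)) (hSa : 5 ≤ Sa.card) (hSb : 4 ≤ Sb.card) (hSc : 3 ≤ Sc.card)
    (h1 : ∀ P ∈ Sa, ev a P = 0 ∧ ev q P = 0)
    (h2 : ∀ P ∈ Sb, ev b P = 0 ∧ ev a P ≠ 0 ∧ ev q P = 0)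
    (h3 : ∀ P ∈ Sc, ev c P = 0 ∧ ev a P ≠ 0 ∧ ev b P ≠ 0 ∧ ev q P = 0)
    {P : ℝ × ℝ} (hP : ev c P = 0) : ev q P = 0 := by
  obtain ⟨r, hr, rfl⟩ := ha.exists_factor (n := 3) hq Sa (by omega) (fun A hA => (h1 A hA).1)
    fun A hA => (h1 A hA).2
  simp only [ev_mul, mul_eq_zero] at *
  obtain ⟨s, hs, rfl⟩ := hb.exists_factor (n := 2) hr Sb (by omega) (fun A hA => (h2 A hA).1)
    fun A hA => (h2 A hA).2.2.resolve_left (h2 A hA).2.1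
  simp only [ev_mul, mul_eq_zero] at *
  obtain ⟨t, -, rfl⟩ := hc.exists_factor (n := 1) hs Sc (by omega) (fun A hA => (h3 A hA).1)
    fun A hA => ((h3 A hA).2.2.2.resolve_left (h3 A hA).2.1).resolve_left (h3 A hA).2.2.1
  simp [ev_mul, hP]

/-- All but at most one of the points of a finite subset of a line lie off another given line. -/
theorem card_filter_ne_zero {l m : MvPolynomial (Fin 2) ℝ} (hl : IsLinePoly l)
    (hm : IsLinePoly m) (hlm : lineSet l ≠ lineSet m) {N : Finset (ℝ × ℝ)}
    [DecidablePred fun P => ev l P ≠ 0] (hN : ∀ P ∈ N, ev m P = 0) :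
    N.card ≤ (N.filter fun P => ev l P ≠ 0).card + 1 := by
  classical
  have hone : (N.filter fun P => ¬ ev l P ≠ 0).card ≤ 1 := by
    refine Finset.card_le_one.2 fun P hP Q hQ => ?_
    simp only [Finset.mem_filter, not_not] at hP hQ
    exact hl.eq_of_mem_of_mem hm hlm hP.2 (hN P hP.1) hQ.2 (hN Q hQ.1)
  have := N.card_filter_add_card_filter_not fun P => ev l P ≠ 0
  omega

/-- The cofactor of a line used by the node `A`. -/
theorem Uses.exists_cofactor {n : ℕ} {X : Set (ℝ × ℝ)} {A : ℝ × ℝ} {l : MvPolynomial (Fin 2) ℝ}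
    (h : Uses (n + 1) X A l) (hl : IsLinePoly l) :
    ∃ q : MvPolynomial (Fin 2) ℝ, q.totalDegree ≤ n ∧ ev q A ≠ 0 ∧
      ∀ B ∈ X, B ≠ A → ev l B ≠ 0 → ev q B = 0 := by
  obtain ⟨p, ⟨hdeg, hA, hB⟩, q, rfl⟩ := h
  refine ⟨q, hl.totalDegree_le_of_mul hdeg, ?_, fun B hBX hne hlB => ?_⟩
  · intro h0
    simp [ev_mul, h0] at hA
  · have := hB B hBX hne
    rw [ev_mul] at this
    exact (mul_eq_zero.mp this).resolve_left hlB

/-- If `lt` misses the five nodes of a line `a`, then no node off `a` lying on one of two further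
five-node lines, node-disjoint from `a` and from each other, uses `lt`. -/
theorem not_uses_of_node_on_third_line {X : Set (ℝ × ℝ)} {a b c lt : MvPolynomial (Fin 2) ℝ}
    (ha : IsLinePoly a) (hb : IsLinePoly b) (hc : IsLinePoly c) (hlt : IsLinePoly lt)
    (hltb : lineSet lt ≠ lineSet b) (hltc : lineSet lt ≠ lineSet c)
    {Na Nb Nc : Finset (ℝ × ℝ)} (hNa : Na.card = 5) (hNb : Nb.card = 5) (hNc : Nc.card = 5)
    (hma : ∀ P, P ∈ Na ↔ P ∈ X ∧ ev a P = 0) (hmb : ∀ P, P ∈ Nb ↔ P ∈ X ∧ ev b P = 0)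
    (hmc : ∀ P, P ∈ Nc ↔ P ∈ X ∧ ev c P = 0)
    (hab : ∀ P ∈ X, ev a P = 0 → ev b P ≠ 0) (hac : ∀ P ∈ X, ev a P = 0 → ev c P ≠ 0)
    (hbc : ∀ P ∈ X, ev b P = 0 → ev c P ≠ 0)
    (hmiss : ∀ P ∈ X, ev a P = 0 → ev lt P ≠ 0)
    {A : ℝ × ℝ} (hA : A ∈ X) (hAc : ev c A = 0) : ¬ Uses 5 X A lt := by
  classical
  intro hU
  obtain ⟨q, hq, hqA, hqX⟩ := hU.exists_cofactor hlt
  refine hqA (ev_eq_zero_of_zeros_on_three_lines ha hb hc hq Na (Nb.filter fun P => ev lt P ≠ 0)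
    ((Nc.filter fun P => ev lt P ≠ 0).erase A) hNa.ge ?_ ?_ ?_ ?_ ?_ hAc)
  · have := card_filter_ne_zero hlt hb hltb (N := Nb) fun P hP => ((hmb P).1 hP).2
    omega
  · have := card_filter_ne_zero hlt hc hltc (N := Nc) fun P hP => ((hmc P).1 hP).2
    have := Finset.pred_card_le_card_erase (s := Nc.filter fun P => ev lt P ≠ 0) (a := A)
    omega
  · intro P hP
    obtain ⟨hPX, hPa⟩ := (hma P).1 hP
    exact ⟨hPa, hqX P hPX (by rintro rfl; exact hac P hA hPa hAc) (hmiss P hPX hPa)⟩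
  · intro P hP
    obtain ⟨hP, hPt⟩ := Finset.mem_filter.1 hP
    obtain ⟨hPX, hPb⟩ := (hmb P).1 hP
    exact ⟨hPb, fun h => hab P hPX h hPb,
      hqX P hPX (by rintro rfl; exact hbc P hA hPb hAc) hPt⟩
  · intro P hP
    obtain ⟨hPA, hP⟩ := Finset.mem_erase.1 hP
    obtain ⟨hP, hPt⟩ := Finset.mem_filter.1 hP
    obtain ⟨hPX, hPc⟩ := (hmc P).1 hP
    exact ⟨hPc, fun h => hac P hPX h hPc, fun h => hbc P hPX h hPc, hqX P hPX hPA hPt⟩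

/-- If `lt` misses the five nodes of a line `c`, then at most one node of `c` uses `lt`, provided
there are two further five-node lines, node-disjoint from `c` and from each other. -/
theorem eq_of_uses_of_uses {X : Set (ℝ × ℝ)} {a b c lt : MvPolynomial (Fin 2) ℝ}
    (ha : IsLinePoly a) (hb : IsLinePoly b) (hc : IsLinePoly c) (hlt : IsLinePoly lt)
    (hlta : lineSet lt ≠ lineSet a) (hltb : lineSet lt ≠ lineSet b)
    {Na Nb Nc : Finset (ℝ × ℝ)} (hNa : Na.card = 5) (hNb : Nb.card = 5) (hNc : Nc.card = 5)
    (hma : ∀ P, P ∈ Na ↔ P ∈ X ∧ ev a P = 0) (hmb : ∀ P, P ∈ Nb ↔ P ∈ X ∧ ev b P = 0)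
    (hmc : ∀ P, P ∈ Nc ↔ P ∈ X ∧ ev c P = 0)
    (hab : ∀ P ∈ X, ev a P = 0 → ev b P ≠ 0) (hac : ∀ P ∈ X, ev a P = 0 → ev c P ≠ 0)
    (hbc : ∀ P ∈ X, ev b P = 0 → ev c P ≠ 0)
    (hmiss : ∀ P ∈ X, ev c P = 0 → ev lt P ≠ 0)
    {A B : ℝ × ℝ} (hA : A ∈ X) (hAc : ev c A = 0) (hB : B ∈ X) (hBc : ev c B = 0)
    (hUA : Uses 5 X A lt) (hUB : Uses 5 X B lt) : A = B := by
  classical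
  by_contra hne
  obtain ⟨q, hq, hqA, hqX⟩ := hUA.exists_cofactor hlt
  obtain ⟨r, hr, hrB, hrX⟩ := hUB.exists_cofactor hlt
  obtain ⟨P, hP⟩ : ∃ P, ∀ Q ∈ Na, Q ≠ P → ev lt Q ≠ 0 := by
    by_cases h : ∃ P ∈ Na, ev lt P = 0
    · obtain ⟨P, hPN, hP⟩ := h
      exact ⟨P, fun Q hQ hQP hQt => hQP (hlt.eq_of_mem_of_mem ha hlta hQt ((hma Q).1 hQ).2 hP
        ((hma P).1 hPN).2)⟩
    · push Not at h
      exact ⟨0, fun Q hQ _ => h Q hQ⟩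
  -- a nontrivial combination of the two cofactors vanishing at all the nodes of `a`
  obtain ⟨x, y, hxy, hxyP⟩ : ∃ x y : ℝ, (x ≠ 0 ∨ y ≠ 0) ∧ x * ev q P + y * ev r P = 0 := by
    by_cases h : ev q P = 0
    · exact ⟨1, 0, Or.inl one_ne_zero, by simp [h]⟩
    · exact ⟨-ev r P, ev q P, Or.inr h, by ring⟩
  have hev : ∀ Q, ev (C x * q + C y * r) Q = x * ev q Q + y * ev r Q := fun Q => by
    simp only [ev_add, ev_mul, ev_C]
  have hcommon : ∀ Q ∈ X, Q ≠ A → Q ≠ B → ev lt Q ≠ 0 → ev (C x * q + C y * r) Q = 0 := by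
    intro Q hQ hQA hQB hQt
    rw [hev, hqX Q hQ hQA hQt, hrX Q hQ hQB hQt]
    ring
  have hvanish : ∀ Q, ev c Q = 0 → ev (C x * q + C y * r) Q = 0 := by
    intro Q hQ
    refine ev_eq_zero_of_zeros_on_three_lines ha hb hc ?_ Na (Nb.filter fun P => ev lt P ≠ 0)
      ((Nc.erase A).erase B) hNa.ge ?_ ?_ ?_ ?_ ?_ hQ
    · refine (totalDegree_add _ _).trans (max_le ?_ ?_)
      · exact (totalDegree_mul _ _).trans (by simpa using hq)
      · exact (totalDegree_mul _ _).trans (by simpa using hr)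
    · have := card_filter_ne_zero hlt hb hltb (N := Nb) fun P hP => ((hmb P).1 hP).2
      omega
    · have := Finset.pred_card_le_card_erase (s := Nc) (a := A)
      have := Finset.pred_card_le_card_erase (s := Nc.erase A) (a := B)
      omega
    · intro R hR
      obtain ⟨hRX, hRa⟩ := (hma R).1 hR
      refine ⟨hRa, ?_⟩
      by_cases hRP : R = P
      · rw [hev, hRP, hxyP]
      · exact hcommon R hRX (by rintro rfl; exact hac R hRX hRa hAc)
          (by rintro rfl; exact hac R hRX hRa hBc) (hP R hR hRP)
    · intro R hR
      obtain ⟨hR, hRt⟩ := Finset.mem_filter.1 hR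
      obtain ⟨hRX, hRb⟩ := (hmb R).1 hR
      exact ⟨hRb, fun h => hab R hRX h hRb, hcommon R hRX
        (by rintro rfl; exact hbc R hRX hRb hAc) (by rintro rfl; exact hbc R hRX hRb hBc) hRt⟩
    · intro R hR
      obtain ⟨hRB, hR⟩ := Finset.mem_erase.1 hR
      obtain ⟨hRA, hR⟩ := Finset.mem_erase.1 hR
      obtain ⟨hRX, hRc⟩ := (hmc R).1 hR
      exact ⟨hRc, fun h => hac R hRX h hRc, fun h => hbc R hRX h hRc,
        hcommon R hRX hRA hRB (hmiss R hRX hRc)⟩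
  have hvA := hvanish A hAc
  have hvB := hvanish B hBc
  rw [hev, hrX A hA hne (hmiss A hA hAc)] at hvA
  rw [hev, hqX B hB (Ne.symm hne) (hmiss B hB hBc)] at hvB
  simp [hqA] at hvA
  simp [hrB] at hvB
  exact hxy.elim (fun h => h hvA) fun h => h hvB

/-- The first three lines of the sequence have five nodes each and share none. -/
theorem MLineSeq.five_nodes_and_disjoint {X : Set (ℝ × ℝ)} (hX : X.Finite) {A0 : ℝ × ℝ}
    {L : Fin 5 → MvPolynomial (Fin 2) ℝ} (hL : MLineSeq X A0 L)
    (hk : ∀ s : Fin 5, s.val < 3 → resCount X L s (L s) = 5) {s : Fin 5} (hs : s.val < 3) :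
    (X ∩ lineSet (L s)).ncard = 5 ∧ ∀ i < s, ∀ P ∈ X, ev (L s) P = 0 → ev (L i) P ≠ 0 := by
  have hzero : ∀ l, resCount X L 0 l = (X ∩ lineSet l).ncard := by
    intro l
    unfold resCount
    congr 1
    ext P
    simp [lineSet]
  have hle : (X ∩ lineSet (L s)).ncard ≤ 5 := by
    rw [← hzero]
    exact (hL.2.2.2 0 s (Fin.zero_le s)).trans_eq (hk 0 (by norm_num))
  have hsub : {B ∈ X | ev (L s) B = 0 ∧ ∀ i : Fin 5, i < s → ev (L i) B ≠ 0} ⊆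
      X ∩ lineSet (L s) := fun P hP => ⟨hP.1, hP.2.1⟩
  have hcard : {B ∈ X | ev (L s) B = 0 ∧ ∀ i : Fin 5, i < s → ev (L i) B ≠ 0}.ncard = 5 := hk s hs
  have heq := Set.eq_of_subset_of_ncard_le hsub (by omega) (hX.inter_of_left _)
  refine ⟨by rw [← heq, hcard], fun i hi P hP hPs => ?_⟩
  have hmem : P ∈ X ∩ lineSet (L s) := ⟨hP, hPs⟩
  rw [← heq] at hmem
  exact hmem.2.2 i hi

/-- in the `(5,5,5,3,2)` setup, if a line `lt ∉ {ℓ1, ℓ2, ℓ3}` does not meet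
some `ℓ_j`, `j ∈ {1,2,3}`, at a node of `X`, then `lt` is used by at most one node of `𝒜`,
and any node of `𝒜` using `lt` lies on `ℓ_j`. -/
theorem at_most_one_user_in_A
    (X : Set (ℝ × ℝ)) (hX : GCSet 5 X) (hnm : NoMaximalLine 5 X)
    (A0 : ℝ × ℝ) (hA0 : A0 ∈ X) (L : Fin 5 → MvPolynomial (Fin 2) ℝ)
    (hL : MLineSeq X A0 L) (hk : ∀ s, resCount X L s (L s) = ![5, 5, 5, 3, 2] s)
    (SA SB : Set (ℝ × ℝ))
    (hSA : SA = X ∩ (lineSet (L 0) ∪ lineSet (L 1) ∪ lineSet (L 2)))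
    (hSB : SB = X \ SA)
    (lt : MvPolynomial (Fin 2) ℝ) (hlt : IsLinePoly lt)
    (hne : ∀ i : Fin 5, i.val < 3 → lineSet lt ≠ lineSet (L i))
    (j : Fin 5) (hj : j.val < 3)
    (hmiss : ∀ P ∈ X, ¬ (ev lt P = 0 ∧ ev (L j) P = 0)) :
    (∀ A1 ∈ SA, ∀ A2 ∈ SA, Uses 5 X A1 lt → Uses 5 X A2 lt → A1 = A2) ∧
    (∀ A ∈ SA, Uses 5 X A lt → ev (L j) A = 0) := by
  have hfin : X.Finite := hX.1.1
  have hk3 : ∀ s : Fin 5, s.val < 3 → resCount X L s (L s) = 5 := by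
    intro s hs
    rw [hk s]
    fin_cases s <;> simp_all
  have hcard : ∀ s : Fin 5, s.val < 3 → (X ∩ lineSet (L s)).ncard = 5 := fun s hs =>
    (hL.five_nodes_and_disjoint hfin hk3 hs).1
  have hdisj : ∀ s t : Fin 5, s.val < 3 → t.val < 3 → s ≠ t →
      ∀ P ∈ X, ev (L s) P = 0 → ev (L t) P ≠ 0 := by
    intro s t hs ht hst P hP hPs hPt
    rcases lt_or_gt_of_ne hst with h | h
    · exact (hL.five_nodes_and_disjoint hfin hk3 ht).2 s h P hP hPt hPs
    · exact (hL.five_nodes_and_disjoint hfin hk3 hs).2 t h P hP hPs hPt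
  let N : Fin 5 → Finset (ℝ × ℝ) := fun s => (hfin.inter_of_left (lineSet (L s))).toFinset
  have hN : ∀ s : Fin 5, s.val < 3 → (N s).card = 5 := fun s hs => by
    rw [← hcard s hs, Set.ncard_eq_toFinset_card _ (hfin.inter_of_left _)]
  have hmem : ∀ s P, P ∈ N s ↔ P ∈ X ∧ ev (L s) P = 0 := fun s P => by
    simp [N, lineSet]
  have hthird : ∀ s t : Fin 5, s.val < 3 → t.val < 3 → s ≠ j → t ≠ j → s ≠ t →
      ∀ A ∈ X, ev (L t) A = 0 → ¬ Uses 5 X A lt := by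
    intro s t hs ht hsj htj hst A hA hAt
    exact not_uses_of_node_on_third_line (hL.1 j) (hL.1 s) (hL.1 t) hlt (hne s hs) (hne t ht)
      (hN j hj) (hN s hs) (hN t ht) (hmem j) (hmem s) (hmem t)
      (hdisj j s hj hs hsj.symm) (hdisj j t hj ht htj.symm) (hdisj s t hs ht hst)
      (fun P hP hPj hPt => hmiss P hP ⟨hPt, hPj⟩) hA hAt
  obtain ⟨i, k, hi, hk', hij, hkj, hik, hall⟩ : ∃ i k : Fin 5, i.val < 3 ∧ k.val < 3 ∧ i ≠ j ∧
      k ≠ j ∧ i ≠ k ∧ ∀ s : Fin 5, s.val < 3 → s = i ∨ s = j ∨ s = k := by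
    clear hmiss hthird
    revert j
    decide
  have hon : ∀ A ∈ SA, Uses 5 X A lt → ev (L j) A = 0 := by
    intro A hA hU
    rw [hSA] at hA
    obtain ⟨hAX, hA⟩ := hA
    obtain ⟨s, hs, hAs⟩ : ∃ s : Fin 5, s.val < 3 ∧ ev (L s) A = 0 := by
      rcases hA with (h | h) | h
      exacts [⟨0, by norm_num, h⟩, ⟨1, by norm_num, h⟩, ⟨2, by norm_num, h⟩]
    rcases hall s hs with rfl | rfl | rfl
    · exact absurd hU (hthird k s hk' hs hkj hij hik.symm A hAX hAs)
    · exact hAs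
    · exact absurd hU (hthird i s hi hs hij hkj hik A hAX hAs)
  refine ⟨fun A1 h1 A2 h2 hU1 hU2 => ?_, hon⟩
  have hSX : SA ⊆ X := hSA ▸ Set.inter_subset_left
  exact eq_of_uses_of_uses (hL.1 i) (hL.1 k) (hL.1 j) hlt (hne i hi) (hne k hk')
    (hN i hi) (hN k hk') (hN j hj) (hmem i) (hmem k) (hmem j)
    (hdisj i k hi hk' hik) (hdisj i j hi hj hij) (hdisj k j hk' hj hkj)
    (fun P hP hPj hPt => hmiss P hP ⟨hPt, hPj⟩)
    (hSX h1) (hon A1 h1 hU1) (hSX h2) (hon A2 h2 hU2) hU1 hU2
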